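/- Lemma 1 (inner product of output states of adaptive linear interferometers, stated as a permanent identity): Let m, n, k, r be natural numbers with n ≤ m, k ≤ m and r ≤ n, let t = (1^n, 0^{m−n}) ∈ Φ_{m,n}, let p, q ∈ Φ_{k,r}, and let M and N be m×m complex matrices. Then Σ_{s ∈ Φ_{m−k, n−r}} (1/s!) · Per(M_{t,(p,s)}) · Per(N_{(q,s),t}) = Σ_{i,j ∈ {0,1}^n, |i| = |j| = r} Per(A^i) · Per(B^j) · Per(C^{i,j}), where A^i := M_{(i, 0^{m−n}), (p, 0^{m−k})} is an r×r matrix, B^j := N_{(q, 0^{m−k}), (j, 0^{m−n})} is an r×r matrix, and C^{i,j} := M_{(1^n − i, 0^{m−n}), (0^k, 1^{m−k})} · N_{(0^k, 1^{m−k}), (1^n − j, 0^{m−n})} is an (n−r)×(n−r) matrix. (Applied with M = U^{p†} and N = V^{q} for adaptive interferometers, the left-hand side times 1/√(p! q!) equals the inner product ⟨ψ_p|ψ_q⟩ of the unnormalised output states corresponding to adaptive measurement outcomes p and q.) -/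

import Mathlib

/-- The permanent of a (generalized square) matrix whose rows and columns are indexed by
finite types of the same cardinality: `Per A = ∑_{σ} ∏_i a_{i, σ(i)}`, the sum ranging over
all bijections from rows to columns. For `α = β = Fin r` this is the usual permanent
`∑_{σ ∈ S_r} ∏_i a_{i σ(i)}`. -/
noncomputable def Per {α β : Type*} [Fintype α] [Fintype β] [DecidableEq α] [DecidableEq β]
    (A : Matrix α β ℂ) : ℂ :=
  ∑ f : α ≃ β, ∏ i : α, A i (f i)

/-- The matrix `M_{u,v}` obtained from an `a × b` matrix `M` by repeating its `i`-th row
`u i` times and its `j`-th column `v j` times (rows/columns of multiplicity zero are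
deleted). -/
def rep {a b : ℕ} (M : Matrix (Fin a) (Fin b) ℂ) (u : Fin a → ℕ) (v : Fin b → ℕ) :
    Matrix ((i : Fin a) × Fin (u i)) ((j : Fin b) × Fin (v j)) ℂ :=
  fun x y => M x.1 y.1

/-- Concatenation `(p, s)` of a length-`k` tuple `p` with a length-`(m-k)` tuple `s`,
viewed as a tuple of length `m` (for `k ≤ m`). -/
def concat {k m : ℕ} (hk : k ≤ m) (p : Fin k → ℕ) (s : Fin (m - k) → ℕ) : Fin m → ℕ :=
  fun i => if h : (i : ℕ) < k then p ⟨i, h⟩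
    else s ⟨(i : ℕ) - k, by have := i.isLt; omega⟩

section helpers

open Finset

theorem Per_reindex {α β α' β' : Type*} [Fintype α] [Fintype β] [DecidableEq α] [DecidableEq β]
    [Fintype α'] [Fintype β'] [DecidableEq α'] [DecidableEq β']
    (A : Matrix α β ℂ) (B : Matrix α' β' ℂ) (e : α ≃ α') (f : β ≃ β')
    (h : ∀ x y, A x y = B (e x) (f y)) : Per A = Per B := by
  unfold Per
  refine Fintype.sum_equiv (Equiv.equivCongr e f) _ _ fun g => ?_
  refine Fintype.prod_equiv e _ _ fun x => ?_
  simp [h]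

theorem Per_transpose {α β : Type*} [Fintype α] [Fintype β] [DecidableEq α] [DecidableEq β]
    (A : Matrix α β ℂ) (B : Matrix β α ℂ) (h : ∀ x y, A x y = B y x) : Per A = Per B := by
  unfold Per
  refine Fintype.sum_equiv ⟨Equiv.symm, Equiv.symm, fun _ => rfl, fun _ => rfl⟩ _ _ fun g => ?_
  refine Fintype.prod_equiv g _ _ fun x => ?_
  simp [h]

theorem Per_eq_zero {α β : Type*} [Fintype α] [Fintype β] [DecidableEq α] [DecidableEq β]
    (A : Matrix α β ℂ) (h : Fintype.card α ≠ Fintype.card β) : Per A = 0 := by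
  unfold Per
  have : IsEmpty (α ≃ β) := ⟨fun e => h (Fintype.card_congr e)⟩
  simp

/-- splitting of an equivalence onto a sum type -/
def splitEquiv {α P S : Type*} (T : α → Prop) [DecidablePred T] :
    {f : α ≃ P ⊕ S // ∀ x, T x ↔ (f x).isLeft = true} ≃ ({x // T x} ≃ P) × ({x // ¬ T x} ≃ S) where
  toFun f :=
    (⟨fun x => (f.1 x.1).getLeft ((f.2 x.1).1 x.2),
      fun y => ⟨f.1.symm (Sum.inl y), by rw [f.2]; simp⟩,
      fun x => by ext; simp,
      fun y => by simp⟩,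
     ⟨fun x => (f.1 x.1).getRight (by have := (f.2 x.1).not.1 x.2; simpa using this),
      fun y => ⟨f.1.symm (Sum.inr y), by rw [f.2]; simp⟩,
      fun x => by ext; simp,
      fun y => by simp⟩)
  invFun g := ⟨(Equiv.sumCompl T).symm.trans (Equiv.sumCongr g.1 g.2), fun x => by
    by_cases h : T x <;> simp [h]⟩
  left_inv f := by
    ext x : 2
    by_cases h : T x <;> simp [h]
  right_inv g := by
    ext x
    · simp
    · simp

theorem Per_laplace {α P S : Type*} [Fintype α] [Fintype P] [Fintype S]
    [DecidableEq α] [DecidableEq P] [DecidableEq S] (A : Matrix α (P ⊕ S) ℂ) :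
    Per A = ∑ T : Finset α,
      Per (fun (x : {x // x ∈ T}) (y : P) => A x (Sum.inl y)) *
      Per (fun (x : {x // ¬ x ∈ T}) (y : S) => A x (Sum.inr y)) := by
  classical
  unfold Per
  rw [← Finset.sum_fiberwise (s := univ)
    (g := fun f : α ≃ P ⊕ S => univ.filter (fun x => (f x).isLeft = true))]
  refine Finset.sum_congr rfl fun T _ => ?_
  rw [Finset.sum_mul_sum, ← Finset.sum_product', Finset.univ_product_univ]
  have : ∀ f : α ≃ P ⊕ S, f ∈ univ.filter (fun f : α ≃ P ⊕ S =>
      univ.filter (fun x => (f x).isLeft = true) = T) ↔ (∀ x, x ∈ T ↔ (f x).isLeft = true) := by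
    intro f
    simp [Finset.ext_iff, iff_comm]
  rw [Finset.sum_subtype _ this]
  refine Fintype.sum_equiv (splitEquiv (fun x => x ∈ T)) _ _ fun f => ?_
  refine (Fintype.prod_subtype_mul_prod_subtype (fun x => x ∈ T) (fun x => (A x (f.1 x) : ℂ))).symm.trans ?_
  congr 1
  · refine Finset.prod_congr (by ext; simp) fun x _ => ?_
    simp [splitEquiv]
  · refine Finset.prod_congr (by ext; simp) fun x _ => ?_
    simp [splitEquiv]

theorem card_fib {α ι : Type*} [Fintype α] [DecidableEq α] [Fintype ι] [DecidableEq ι]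
    (s : ι → ℕ) (g : α → ι) :
    (univ.filter (fun e : α ≃ (Σ l, Fin (s l)) => (fun a => (e a).1) = g)).card =
      if (fun l => Fintype.card {a // g a = l}) = s then ∏ l, (s l).factorial else 0 := by
  classical
  split_ifs with h
  · have h' : ∀ l, Nonempty ({a // g a = l} ≃ Fin (s l)) := fun l =>
      ⟨Fintype.equivFinOfCardEq (congrFun h l)⟩
    have φ : ∀ l, ({a // g a = l} ≃ Fin (s l)) := fun l => Classical.choice (h' l)
    let e0 : α ≃ (Σ l, Fin (s l)) :=
      (Equiv.sigmaFiberEquiv g).symm.trans (Equiv.sigmaCongrRight fun l => φ l)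
    have he0 : ∀ a, (e0 a).1 = g a := fun a => rfl
    have := DomMulAct.stabilizer_card g
    rw [← Fintype.card_subtype]
    have h2 : ∀ l, Fintype.card {a // g a = l} = s l := congrFun h
    simp only [h2] at this
    rw [← this]
    refine Fintype.card_congr (Equiv.subtypeEquiv (Equiv.equivCongr (Equiv.refl α) e0.symm) ?_)
    intro e
    have : ∀ a, g (e0.symm (e a)) = (e a).1 := fun a => by rw [← he0]; simp
    simp [funext_iff, this]
  · rw [Finset.card_eq_zero, Finset.filter_eq_empty_iff]
    rintro e - rfl
    apply h
    funext l
    rw [Fintype.card_congr (Equiv.subtypeEquiv (q := fun x : (Σ l, Fin (s l)) => x.1 = l) e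
      (fun a => Iff.rfl)), Fintype.card_congr (Equiv.sigmaSubtype l), Fintype.card_fin]

theorem Per_cauchy {α β : Type*} [Fintype α] [Fintype β] [DecidableEq α] [DecidableEq β]
    (c d : ℕ) (hd : Fintype.card α = d) (X : Matrix α (Fin c) ℂ) (Y : Matrix (Fin c) β ℂ) :
    ∑ s ∈ Finset.Nat.antidiagonalTuple c d, (1 / ∏ i, ((s i).factorial : ℂ)) *
      (Per (fun (x : α) (y : Σ l, Fin (s l)) => X x y.1) *
       Per (fun (x : Σ l, Fin (s l)) (y : β) => Y x.1 y)) = Per (X * Y) := by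
  classical
  have key : ∀ s : Fin c → ℕ, (1 / ∏ i, ((s i).factorial : ℂ)) *
      (Per (fun (x : α) (y : Σ l, Fin (s l)) => X x y.1) *
       Per (fun (x : Σ l, Fin (s l)) (y : β) => Y x.1 y)) =
      ∑ g : α → Fin c with (fun l => Fintype.card {a // g a = l}) = s,
        ∑ f : α ≃ β, ∏ a, (X a (g a) * Y (g a) (f a)) := by
    intro s
    have h1 : Per (fun (x : α) (y : Σ l, Fin (s l)) => X x y.1) *
       Per (fun (x : Σ l, Fin (s l)) (y : β) => Y x.1 y) =
       ∑ e : α ≃ (Σ l, Fin (s l)), ∑ f : α ≃ β, ∏ a, (X a (e a).1 * Y (e a).1 (f a)) := by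
      unfold Per
      rw [Finset.sum_mul]
      refine Finset.sum_congr rfl fun e _ => ?_
      rw [Finset.mul_sum]
      refine Fintype.sum_equiv (Equiv.equivCongr e.symm (Equiv.refl β)) _ _ fun f => ?_
      rw [Finset.prod_mul_distrib]
      congr 1
      refine Fintype.prod_equiv e.symm _ _ fun x => ?_
      simp
    rw [h1, ← Finset.sum_fiberwise (s := univ)
      (g := fun e : α ≃ (Σ l, Fin (s l)) => fun a => (e a).1)]
    have h2 : ∀ g : α → Fin c,
        ∑ e : α ≃ (Σ l, Fin (s l)) with (fun a => (e a).1) = g,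
          ∑ f : α ≃ β, ∏ a, (X a (e a).1 * Y (e a).1 (f a)) =
        (if (fun l => Fintype.card {a // g a = l}) = s then ((∏ l, (s l).factorial : ℕ) : ℂ) else 0) *
          ∑ f : α ≃ β, ∏ a, (X a (g a) * Y (g a) (f a)) := by
      intro g
      have := card_fib s g
      rw [Finset.sum_congr rfl (g := fun _ => ∑ f : α ≃ β, ∏ a, (X a (g a) * Y (g a) (f a)))]
      · rw [Finset.sum_const, this, nsmul_eq_mul]
        split_ifs <;> simp
      · intro e he
        simp only [mem_filter, mem_univ, true_and] at he
        subst he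
        rfl
    rw [Finset.sum_congr rfl (fun g _ => h2 g), Finset.mul_sum, Finset.sum_filter]
    refine Finset.sum_congr rfl fun g _ => ?_
    split_ifs
    · rw [← mul_assoc]
      have : (∏ l, ((s l).factorial : ℂ)) ≠ 0 :=
        Finset.prod_ne_zero_iff.2 fun l _ => by exact_mod_cast (s l).factorial_ne_zero
      push_cast
      rw [one_div, inv_mul_cancel₀ this, one_mul]
    · simp
  rw [Finset.sum_congr rfl (fun s _ => key s)]
  rw [Finset.sum_fiberwise_of_maps_to]
  · unfold Per
    rw [Finset.sum_comm]
    refine Finset.sum_congr rfl fun f _ => ?_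
    simp only [Matrix.mul_apply]
    rw [Finset.prod_univ_sum]
    simp
  · intro g _
    rw [Finset.Nat.mem_antidiagonalTuple, ← hd, ← Fintype.card_sigma]
    exact Fintype.card_congr (Equiv.sigmaFiberEquiv g)

/-- right inclusion -/
def rinc {k m : ℕ} (hk : k ≤ m) (i : Fin (m - k)) : Fin m := ⟨k + i, by omega⟩

theorem concat_l {k m : ℕ} (hk : k ≤ m) (p : Fin k → ℕ) (s : Fin (m - k) → ℕ) (i : Fin k) :
    p i = concat hk p s (Fin.castLE hk i) := by
  unfold concat
  simp

theorem concat_r {k m : ℕ} (hk : k ≤ m) (p : Fin k → ℕ) (s : Fin (m - k) → ℕ) (i : Fin (m - k)) :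
    s i = concat hk p s (rinc hk i) := by
  unfold concat rinc
  simp

/-- split of the repeated index type -/
def concatEquiv {k m : ℕ} (hk : k ≤ m) (p : Fin k → ℕ) (s : Fin (m - k) → ℕ) :
    ((Σ i, Fin (p i)) ⊕ (Σ i, Fin (s i))) ≃ (Σ j, Fin (concat hk p s j)) where
  toFun := Sum.elim
    (fun x => ⟨Fin.castLE hk x.1, Fin.cast (concat_l hk p s x.1) x.2⟩)
    (fun x => ⟨rinc hk x.1, Fin.cast (concat_r hk p s x.1) x.2⟩)
  invFun x := if h : (x.1 : ℕ) < k then Sum.inl ⟨⟨x.1, h⟩, Fin.cast (by simp [concat, h]) x.2⟩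
    else Sum.inr ⟨⟨x.1 - k, by omega⟩, Fin.cast (by simp [concat, h]) x.2⟩
  left_inv := by
    rintro (⟨i, x⟩ | ⟨i, x⟩)
    · simp
      rfl
    · have hh : (⟨(rinc hk i : ℕ) - k, by have := i.2; simp [rinc]⟩ : Fin (m - k)) = i := by
        ext; simp [rinc]
      have h : ¬ (rinc hk i : ℕ) < k := by simp [rinc]
      refine (dif_neg h).trans (congrArg Sum.inr ?_)
      refine Sigma.ext hh ?_
      refine (Fin.heq_ext_iff (congrArg s hh)).2 ?_
      rfl
  right_inv := by
    rintro ⟨i, x⟩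
    by_cases h : (i : ℕ) < k
    · simp [h]
    · have : rinc hk ⟨i - k, by omega⟩ = i := by ext; simp [rinc]; omega
      simp only [h, dite_false, Sum.elim_inr]
      refine Sigma.ext this ?_
      simp only
      rw [Fin.heq_ext_iff (by simp [this])]
      simp

theorem concatEquiv_fst {k m : ℕ} (hk : k ≤ m) (p : Fin k → ℕ) (s : Fin (m - k) → ℕ) (x) :
    (concatEquiv hk p s x).1 = Sum.elim (fun x => Fin.castLE hk x.1) (fun x => rinc hk x.1) x := by
  rcases x with x | x <;> rfl

/-- rows given by a 0/1 vector -/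
def rowEquiv {n : ℕ} (i : Fin n → ℕ) (T : Fin n → Prop) (h1 : ∀ l, T l → i l = 1)
    (h0 : ∀ l, ¬ T l → i l = 0) : {l // T l} ≃ (Σ l, Fin (i l)) where
  toFun x := ⟨x.1, ⟨0, by simp [h1 x.1 x.2]⟩⟩
  invFun x := ⟨x.1, by
    by_contra h
    have := x.2.2
    have := h0 _ h
    omega⟩
  left_inv x := rfl
  right_inv := by
    rintro ⟨l, x⟩
    have : T l := by
      by_contra h
      have := x.2
      have := h0 _ h
      omega
    have := h1 l this
    refine Sigma.ext rfl (heq_of_eq ?_)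
    ext
    have := x.2
    simp
    omega

/-- left part with empty right part -/
def leftEquiv {n m : ℕ} (hn : n ≤ m) (p : Fin n → ℕ) :
    (Σ l, Fin (p l)) ≃ (Σ j, Fin (concat hn p (fun _ => 0) j)) :=
  haveI : IsEmpty (Σ _ : Fin (m - n), Fin 0) := ⟨fun x => x.2.elim0⟩
  (Equiv.sumEmpty (Σ l, Fin (p l)) (Σ _ : Fin (m - n), Fin 0)).symm.trans (concatEquiv hn p _)

theorem leftEquiv_fst {n m : ℕ} (hn : n ≤ m) (p : Fin n → ℕ) (x) :
    (leftEquiv hn p x).1 = Fin.castLE hn x.1 := rfl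

/-- right part with empty left part -/
def rightEquiv {n m : ℕ} (hn : n ≤ m) :
    Fin (m - n) ≃ (Σ j, Fin (concat hn (fun _ => 0) (fun _ => 1) j)) :=
  haveI : IsEmpty (Σ _ : Fin n, Fin 0) := ⟨fun x => x.2.elim0⟩
  ((Equiv.uniqueSigma (fun _ : Unit => Fin (m-n))).symm.trans
   ((Equiv.sigmaEquivProd _ _).trans ((Equiv.prodComm _ _).trans
     ((Equiv.sigmaEquivProd _ _).symm.trans (Equiv.sigmaCongrRight fun _ => (finOneEquiv).symm))))).trans
  ((Equiv.emptySum (Σ _ : Fin n, Fin 0) (Σ _ : Fin (m - n), Fin 1)).symm.trans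
    (concatEquiv hn _ _))

theorem rightEquiv_fst {n m : ℕ} (hn : n ≤ m) (x) :
    (rightEquiv hn x).1 = rinc hn x := rfl

theorem sum_bin (n r : ℕ) (F : (Fin n → ℕ) → ℂ) (G : Finset (Fin n) → ℂ)
    (hG : ∀ T, T.card ≠ r → G T = 0)
    (h : ∀ i T, (∀ l, l ∈ T → i l = 1) → (∀ l, l ∉ T → i l = 0) → T.card = r → F i = G T) :
    ∑ i ∈ (Finset.Nat.antidiagonalTuple n r).filter (fun i => ∀ l, i l ≤ 1), F i = ∑ T, G T := by
  classical
  rw [← Finset.sum_filter_of_ne (s := univ) (p := fun T : Finset (Fin n) => T.card = r)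
    (fun T _ hT => by by_contra hc; exact hT (hG T hc))]
  have hc : ∀ i : Fin n → ℕ, (∀ l, i l ≤ 1) → (univ.filter (fun l => i l = 1)).card = ∑ l, i l := by
    intro i hi
    rw [Finset.card_filter]
    refine Finset.sum_congr rfl fun l _ => ?_
    have := hi l
    split_ifs <;> omega
  refine Finset.sum_bij' (fun i _ => univ.filter (fun l => i l = 1))
    (fun T _ => fun l => if l ∈ T then 1 else 0) ?_ ?_ ?_ ?_ ?_
  · intro i hi
    simp only [mem_filter, Finset.Nat.mem_antidiagonalTuple, mem_univ, true_and] at hi ⊢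
    rw [hc i hi.2, hi.1]
  · intro T hT
    simp only [mem_filter, Finset.Nat.mem_antidiagonalTuple, mem_univ, true_and] at hT ⊢
    refine ⟨by simp [hT], fun l => by split_ifs <;> simp⟩
  · intro i hi
    simp only [mem_filter, Finset.Nat.mem_antidiagonalTuple] at hi
    funext l
    have := hi.2 l
    simp only [mem_filter, mem_univ, true_and]
    split_ifs <;> omega
  · intro T hT
    ext l
    simp
  · intro i hi
    simp only [mem_filter, Finset.Nat.mem_antidiagonalTuple] at hi
    apply h
    · simp
    · intro l hl
      have := hi.2 l
      simp at hl
      omega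
    · rw [hc i hi.2, hi.1]

end helpers

/-- Lemma 1: the inner product of output states of adaptive linear interferometers as a
permanent identity. For `n ≤ m`, `k ≤ m`, `r ≤ n`, `t = (1^n, 0^{m-n})`, `p, q ∈ Φ_{k,r}`
and `m × m` matrices `M`, `N`,
`∑_{s ∈ Φ_{m-k,n-r}} (1/s!) Per(M_{t,(p,s)}) Per(N_{(q,s),t})
  = ∑_{i,j ∈ {0,1}^n, |i|=|j|=r} Per(A^i) Per(B^j) Per(C^{i,j})`,
where `A^i = M_{(i,0^{m-n}),(p,0^{m-k})}`, `B^j = N_{(q,0^{m-k}),(j,0^{m-n})}` and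
`C^{i,j} = M_{(1^n-i,0^{m-n}),(0^k,1^{m-k})} · N_{(0^k,1^{m-k}),(1^n-j,0^{m-n})}`. -/
theorem inner_product_adaptive (m n k r : ℕ) (hn : n ≤ m) (hk : k ≤ m) (hr : r ≤ n)
    (p q : Fin k → ℕ) (hp : ∑ i, p i = r) (hq : ∑ i, q i = r)
    (M N : Matrix (Fin m) (Fin m) ℂ) :
    ∑ s ∈ Finset.Nat.antidiagonalTuple (m - k) (n - r),
        (1 / ∏ i, ((s i).factorial : ℂ)) *
          (Per (rep M (concat hn (fun _ => 1) (fun _ => 0)) (concat hk p s)) *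
            Per (rep N (concat hk q s) (concat hn (fun _ => 1) (fun _ => 0)))) =
      ∑ i ∈ (Finset.Nat.antidiagonalTuple n r).filter (fun i => ∀ l, i l ≤ 1),
        ∑ j ∈ (Finset.Nat.antidiagonalTuple n r).filter (fun j => ∀ l, j l ≤ 1),
          Per (rep M (concat hn i (fun _ => 0)) (concat hk p (fun _ => 0))) *
            Per (rep N (concat hk q (fun _ => 0)) (concat hn j (fun _ => 0))) *
            Per (rep M (concat hn (fun l => 1 - i l) (fun _ => 0))
                    (concat hk (fun _ => 0) (fun _ => 1)) *
                 rep N (concat hk (fun _ => 0) (fun _ => 1))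
                    (concat hn (fun l => 1 - j l) (fun _ => 0))) := by
  have cardP : ∀ p : Fin k → ℕ, ∑ i, p i = r → Fintype.card (Σ i, Fin (p i)) = r := by
    intro p hp
    simp [hp]
  let MA : Finset (Fin n) → ℂ := fun T =>
    Per (fun (x : {x // x ∈ T}) (y : Σ i, Fin (p i)) => M (Fin.castLE hn x) (Fin.castLE hk y.1))
  let NB : Finset (Fin n) → ℂ := fun T =>
    Per (fun (y : {x // x ∈ T}) (x : Σ i, Fin (q i)) => N (Fin.castLE hk x.1) (Fin.castLE hn y))
  let X : ∀ T : Finset (Fin n), Matrix {x // ¬ x ∈ T} (Fin (m - k)) ℂ :=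
    fun T x y => M (Fin.castLE hn x) (rinc hk y)
  let Y : ∀ T : Finset (Fin n), Matrix (Fin (m - k)) {x // ¬ x ∈ T} ℂ :=
    fun T x y => N (rinc hk x) (Fin.castLE hn y)
  have hMA : ∀ T, T.card ≠ r → MA T = 0 := fun T hT =>
    Per_eq_zero _ (by rw [cardP p hp]; simpa using hT)
  have hNB : ∀ T, T.card ≠ r → NB T = 0 := fun T hT =>
    Per_eq_zero _ (by rw [cardP q hq]; simpa using hT)
  let ones : Fin n ≃ (Σ j, Fin (concat hn (fun _ => 1) (fun _ => 0) j)) :=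
    (Equiv.Set.univ (Fin n)).symm.trans
      ((rowEquiv (fun _ : Fin n => 1) (fun l => l ∈ Set.univ) (fun _ _ => rfl)
        (fun l h => absurd (Set.mem_univ l) h)).trans (leftEquiv hn _))
  have hones : ∀ x, (ones x).1 = Fin.castLE hn x := fun _ => rfl
  have hM : ∀ s, Per (rep M (concat hn (fun _ => 1) (fun _ => 0)) (concat hk p s)) =
      ∑ T, MA T * Per (fun (x : {x // ¬ x ∈ T}) (y : Σ l, Fin (s l)) => X T x y.1) := by
    intro s
    refine Eq.trans (b := Per (fun (x : Fin n) (y : (Σ i, Fin (p i)) ⊕ (Σ i, Fin (s i))) =>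
      M (Fin.castLE hn x) (Sum.elim (fun x => Fin.castLE hk x.1) (fun x => rinc hk x.1) y))) ?_ ((Per_laplace _).trans (Finset.sum_congr rfl fun T _ => congrArg₂ (· * ·)
        (Per_reindex _ _ (Equiv.refl _) (Equiv.refl _) fun _ _ => rfl)
        (Per_reindex _ _ (Equiv.refl _) (Equiv.refl _) fun _ _ => rfl)))
    symm
    refine Per_reindex _ _ ones (concatEquiv hk p s) fun x y => ?_
    rw [rep, hones, concatEquiv_fst]
  have hN : ∀ s, Per (rep N (concat hk q s) (concat hn (fun _ => 1) (fun _ => 0))) =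
      ∑ T, NB T * Per (fun (x : Σ l, Fin (s l)) (y : {x // ¬ x ∈ T}) => Y T x.1 y) := by
    intro s
    have : ∀ T, Per (fun (x : Σ l, Fin (s l)) (y : {x // ¬ x ∈ T}) => Y T x.1 y) =
      Per (fun (y : {x // ¬ x ∈ T}) (x : Σ l, Fin (s l)) => Y T x.1 y) := fun T =>
        Per_transpose _ _ fun _ _ => rfl
    simp only [this]
    refine Eq.trans (b := Per (fun (y : Fin n) (x : (Σ i, Fin (q i)) ⊕ (Σ i, Fin (s i))) =>
      N (Sum.elim (fun x => Fin.castLE hk x.1) (fun x => rinc hk x.1) x) (Fin.castLE hn y))) ?_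
      ((Per_laplace _).trans (Finset.sum_congr rfl fun T _ => congrArg₂ (· * ·)
        (Per_reindex _ _ (Equiv.refl _) (Equiv.refl _) fun _ _ => rfl)
        (Per_reindex _ _ (Equiv.refl _) (Equiv.refl _) fun _ _ => rfl)))
    rw [Per_transpose _ (fun x y => rep N (concat hk q s) (concat hn (fun _ => 1) (fun _ => 0)) y x)
      (fun _ _ => rfl)]
    symm
    refine Per_reindex _ _ ones (concatEquiv hk q s) fun x y => ?_
    rw [rep, hones, concatEquiv_fst]
  have hL : ∑ s ∈ Finset.Nat.antidiagonalTuple (m - k) (n - r),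
        (1 / ∏ i, ((s i).factorial : ℂ)) *
          (Per (rep M (concat hn (fun _ => 1) (fun _ => 0)) (concat hk p s)) *
            Per (rep N (concat hk q s) (concat hn (fun _ => 1) (fun _ => 0)))) =
      ∑ T, ∑ T', MA T * NB T' * Per (X T * Y T') := by
    simp only [hM, hN, Finset.sum_mul_sum]
    simp only [Finset.mul_sum]
    rw [Finset.sum_comm]
    refine Finset.sum_congr rfl fun T _ => ?_
    rw [Finset.sum_comm]
    refine Finset.sum_congr rfl fun T' _ => ?_
    by_cases hT : T.card = r
    · rw [← Per_cauchy (m - k) (n - r) (by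
        rw [Fintype.card_subtype_compl]; simp [hT]) (X T) (Y T'), Finset.mul_sum]
      refine Finset.sum_congr rfl fun s _ => ?_
      ring
    · simp [hMA T hT]
  rw [hL]
  symm
  refine sum_bin n r _ _ (fun T hT => by simp [hMA T hT]) fun i T hi1 hi0 hT => ?_
  refine sum_bin n r _ _ (fun T' hT' => by simp [hNB T' hT']) fun j T' hj1 hj0 hT' => ?_
  congr 1
  · congr 1
    · symm
      refine Per_reindex _ _ ((rowEquiv i (fun l => l ∈ T) hi1 hi0).trans (leftEquiv hn i))
        (leftEquiv hk p) fun x y => rfl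
    · rw [Per_transpose _ (fun x y => rep N (concat hk q (fun _ => 0)) (concat hn j (fun _ => 0)) y x)
        (fun _ _ => rfl)]
      symm
      refine Per_reindex _ _ ((rowEquiv j (fun l => l ∈ T') hj1 hj0).trans (leftEquiv hn j))
        (leftEquiv hk q) fun x y => rfl
  · symm
    refine Per_reindex _ _
      ((rowEquiv (fun l => 1 - i l) (fun l => ¬ l ∈ T) (fun l h => by simp [hi0 l h])
        (fun l h => by simp [hi1 l (not_not.1 h)])).trans (leftEquiv hn _))
      ((rowEquiv (fun l => 1 - j l) (fun l => ¬ l ∈ T') (fun l h => by simp [hj0 l h])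
        (fun l h => by simp [hj1 l (not_not.1 h)])).trans (leftEquiv hn _)) fun x y => ?_
    rw [Matrix.mul_apply, Matrix.mul_apply]
    exact Fintype.sum_equiv (rightEquiv hk) _ _ fun z => rfl
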